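/- Fix integers N ≥ 1 and ℓ ≥ 0 and set c = N + ℓ. Let S be the (finite) set of signatures h of length N with h_N = 0 and h₁ ≤ ℓ. For h ∈ S set H(h) = (Σ_{k=1}^N (h_k + N − k))/N and define D(h) ∈ ℂ^N by D(h)_j = exp(2πi·(h_j + N − j − H(h))/c). Then: (1) for each h ∈ S the N complex numbers D(h)₁, …, D(h)_N are pairwise distinct; (2) defining, for a signature f and a point t ∈ ℂ^N with pairwise distinct coordinates, X_f(t) = det((t_j)^{f_i+N−i})_{i,j=1}^{N} / ∏_{i<j}(t_i − t_j), the family of functions (h ↦ X_f(D(h)))_{f ∈ S}, viewed as elements of the space of ℂ-valued functions on S, is linearly independent over ℂ. -/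

import Mathlib

/-- The point `D(h) ∈ ℂ^N` attached to a normalised permissible signature `h`. -/
noncomputable def Dpoint (N ℓ : ℕ) (h : Fin N → ℤ) : Fin N → ℂ :=
  fun j => Complex.exp (2 * (Real.pi : ℂ) * Complex.I *
    (((h j : ℂ) + (N : ℂ) - 1 - ((j : ℕ) : ℂ) -
        (∑ k : Fin N, ((h k : ℂ) + (N : ℂ) - 1 - ((k : ℕ) : ℂ))) / (N : ℂ)) /
      ((N : ℂ) + (ℓ : ℂ))))

/-- The Weyl quotient `X_f(t) = det(t_j^{f_i+N−i}) / ∏_{i<j}(t_i − t_j)`. -/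
noncomputable def weylQuotient (N : ℕ) (f : Fin N → ℤ) (t : Fin N → ℂ) : ℂ :=
  Matrix.det (Matrix.of fun i j : Fin N => t j ^ (f i + (N : ℤ) - 1 - (i : ℕ))) /
    ∏ p ∈ Finset.univ.filter (fun p : Fin N × Fin N => p.1 < p.2), (t p.1 - t p.2)

/-- The set of normalised signatures permissible at level `ℓ`, as a subtype. -/
def PermSig (N ℓ : ℕ) (hN : 1 ≤ N) : Type :=
  {f : Fin N → ℤ // (∀ i j : Fin N, i ≤ j → f j ≤ f i) ∧
    f ⟨N - 1, by omega⟩ = 0 ∧ f ⟨0, by omega⟩ ≤ (ℓ : ℤ)}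

namespace WeylAlternant

open Finset

/-- The strictly decreasing sequence `f_i + N - i` attached to a signature `f`. -/
def shifted {N : ℕ} (f : Fin N → ℤ) (i : Fin N) : ℤ := f i + N - 1 - (i : ℕ)

theorem shifted_strictAnti {N : ℕ} {f : Fin N → ℤ} (hf : ∀ i j : Fin N, i ≤ j → f j ≤ f i) :
    StrictAnti (shifted f) := by
  intro i j hij
  have h1 := hf i j hij.le
  have h2 : (i : ℕ) < j := hij
  simp only [shifted]
  omega

theorem shifted_nonneg {N : ℕ} (hN : 1 ≤ N) {f : Fin N → ℤ}
    (hf : ∀ i j : Fin N, i ≤ j → f j ≤ f i) (h0 : f ⟨N - 1, by omega⟩ = 0) (i : Fin N) :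
    0 ≤ shifted f i := by
  have h1 := hf i ⟨N - 1, by omega⟩ (Fin.le_def.2 (by simp only; omega))
  simp only [shifted]
  omega

theorem shifted_lt {N ℓ : ℕ} (hN : 1 ≤ N) {f : Fin N → ℤ}
    (hf : ∀ i j : Fin N, i ≤ j → f j ≤ f i) (hl : f ⟨0, by omega⟩ ≤ (ℓ : ℤ)) (i : Fin N) :
    shifted f i < N + ℓ := by
  have h1 := hf ⟨0, by omega⟩ i (Fin.le_def.2 (by simp))
  simp only [shifted]
  omega

theorem shifted_last {N : ℕ} (hN : 1 ≤ N) {f : Fin N → ℤ} (h0 : f ⟨N - 1, by omega⟩ = 0) :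
    shifted f ⟨N - 1, by omega⟩ = 0 := by
  simp only [shifted, h0]
  omega

theorem shifted_injective {N : ℕ} : Function.Injective (shifted (N := N)) := by
  intro f g h
  ext i
  have := congrFun h i
  simp only [shifted] at this
  omega

theorem Dpoint_eq (N ℓ : ℕ) (h : Fin N → ℤ) (j : Fin N) :
    Dpoint N ℓ h j = Complex.exp (2 * (Real.pi : ℂ) * Complex.I *
      (((shifted h j : ℂ) - (∑ k, (shifted h k : ℂ)) / N) / ((N : ℂ) + ℓ))) := by
  simp only [Dpoint, shifted]
  push_cast
  rfl

theorem Dpoint_ne_zero (N ℓ : ℕ) (h : Fin N → ℤ) (j : Fin N) : Dpoint N ℓ h j ≠ 0 :=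
  Complex.exp_ne_zero _

theorem level_ne_zero {N : ℕ} (ℓ : ℕ) (hN : 1 ≤ N) : (N : ℂ) + ℓ ≠ 0 := by
  norm_cast
  omega

theorem Dpoint_eq_Dpoint_iff {N ℓ : ℕ} (hN : 1 ≤ N) (f g : Fin N → ℤ) (i j : Fin N) :
    Dpoint N ℓ f i = Dpoint N ℓ g j ↔ ∃ m : ℤ,
      (shifted f i : ℂ) - (∑ k, (shifted f k : ℂ)) / N =
        (shifted g j : ℂ) - (∑ k, (shifted g k : ℂ)) / N + m * ((N : ℂ) + ℓ) := by
  have hc := level_ne_zero ℓ hN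
  have hpi := Complex.two_pi_I_ne_zero
  rw [Dpoint_eq, Dpoint_eq, Complex.exp_eq_exp_iff_exists_int]
  refine exists_congr fun m => ?_
  rw [mul_comm (m : ℂ) (2 * (Real.pi : ℂ) * Complex.I), ← mul_add, mul_right_inj' hpi,
    div_eq_iff hc, add_mul, div_mul_cancel₀ _ hc]

theorem Dpoint_injective {N ℓ : ℕ} (hN : 1 ≤ N) {h : Fin N → ℤ}
    (hh : ∀ i j : Fin N, i ≤ j → h j ≤ h i) (h0 : h ⟨N - 1, by omega⟩ = 0)
    (hl : h ⟨0, by omega⟩ ≤ (ℓ : ℤ)) : Function.Injective (Dpoint N ℓ h) := by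
  intro i j hij
  obtain ⟨m, hm⟩ := (Dpoint_eq_Dpoint_iff hN h h i j).1 hij
  have hm' : shifted h i = shifted h j + m * ((N : ℤ) + ℓ) := by
    have : (shifted h i : ℂ) = shifted h j + m * ((N : ℂ) + ℓ) := by linear_combination hm
    exact_mod_cast this
  have hi := shifted_nonneg hN hh h0 i
  have hj := shifted_nonneg hN hh h0 j
  have hi' := shifted_lt hN hh hl i
  have hj' := shifted_lt hN hh hl j
  have hm0 : m = 0 := by
    by_contra hne
    rcases lt_or_gt_of_ne hne with h | h <;> nlinarith
  apply (shifted_strictAnti hh).injective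
  simpa [hm0] using hm'

theorem prod_Dpoint {N : ℕ} (ℓ : ℕ) (hN : 1 ≤ N) (h : Fin N → ℤ) :
    ∏ j, Dpoint N ℓ h j = 1 := by
  have hN' : (N : ℂ) ≠ 0 := by norm_cast; omega
  simp only [Dpoint_eq]
  rw [← Complex.exp_sum, ← mul_sum, ← sum_div, sum_sub_distrib]
  simp [mul_div_cancel₀ _ hN']

theorem Dpoint_zpow_level {N : ℕ} (ℓ : ℕ) (hN : 1 ≤ N) (h : Fin N → ℤ) (j : Fin N) :
    Dpoint N ℓ h j ^ ((N : ℤ) + ℓ) =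
      Complex.exp (2 * (Real.pi : ℂ) * Complex.I * (-(∑ k, (shifted h k : ℂ)) / N)) := by
  have hc := level_ne_zero ℓ hN
  rw [Dpoint_eq, ← Complex.exp_int_mul, Complex.exp_eq_exp_iff_exists_int]
  refine ⟨shifted h j, ?_⟩
  push_cast
  field_simp
  ring

/-- Up to a permutation of coordinates, `D(f)` determines the normalised signature `f`. -/
theorem eq_of_Dpoint_eq_comp_perm {N ℓ : ℕ} (hN : 1 ≤ N) {f g : Fin N → ℤ}
    (hf : ∀ i j : Fin N, i ≤ j → f j ≤ f i) (hf0 : f ⟨N - 1, by omega⟩ = 0)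
    (hfl : f ⟨0, by omega⟩ ≤ (ℓ : ℤ))
    (hg : ∀ i j : Fin N, i ≤ j → g j ≤ g i) (hg0 : g ⟨N - 1, by omega⟩ = 0)
    (hgl : g ⟨0, by omega⟩ ≤ (ℓ : ℤ)) (π : Equiv.Perm (Fin N))
    (h : ∀ i, Dpoint N ℓ f i = Dpoint N ℓ g (π i)) : f = g := by
  have hN' : (N : ℂ) ≠ 0 := by norm_cast; omega
  have hc := level_ne_zero ℓ hN
  choose m hm using fun i => (Dpoint_eq_Dpoint_iff hN f g i (π i)).1 (h i)
  have hsum : ∑ i, m i = 0 := by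
    have h1 := sum_congr rfl fun i (_ : i ∈ univ) => hm i
    rw [sum_add_distrib, sum_sub_distrib, sum_sub_distrib, ← sum_mul,
      Equiv.sum_comp π (fun i => (shifted g i : ℂ))] at h1
    simp only [sum_const, card_univ, Fintype.card_fin, nsmul_eq_mul, mul_div_cancel₀ _ hN',
      sub_self, zero_add] at h1
    have h2 := (mul_eq_zero.1 h1.symm).resolve_right hc
    exact_mod_cast h2
  have hdiff : ∀ i j, shifted f i - shifted f j =
      shifted g (π i) - shifted g (π j) + (m i - m j) * ((N : ℤ) + ℓ) := by
    intro i j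
    have : (shifted f i : ℂ) - shifted f j =
      shifted g (π i) - shifted g (π j) + (m i - m j) * ((N : ℂ) + ℓ) := by
      linear_combination hm i - hm j
    exact_mod_cast this
  have fnn := shifted_nonneg hN hf hf0
  have flt := shifted_lt hN hf hfl
  have gnn := shifted_nonneg hN hg hg0
  have glt := shifted_lt hN hg hgl
  have hm0 : ∀ i, m i = 0 := by
    by_contra! hne
    obtain ⟨i, -, hi⟩ := exists_pos_of_sum_zero_of_exists_nonzero m hsum
      (by obtain ⟨i, hi⟩ := hne; exact ⟨i, mem_univ i, hi⟩)
    obtain ⟨j, -, hj⟩ := exists_pos_of_sum_zero_of_exists_nonzero (s := univ) (fun k => -m k)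
      (by simp [hsum]) (by obtain ⟨i, hi⟩ := hne; exact ⟨i, mem_univ i, by simpa using hi⟩)
    have h1 := hdiff i j
    nlinarith [fnn i, fnn j, flt i, flt j, gnn (π i), gnn (π j), glt (π i), glt (π j)]
  simp only [hm0, sub_self, zero_mul, add_zero] at hdiff
  have heq : ∀ i, shifted f i = shifted g (π i) := by
    intro i
    set e : Fin N := ⟨N - 1, by omega⟩
    have h1 := hdiff i e
    have h2 := hdiff i (π.symm e)
    rw [Equiv.apply_symm_apply] at h2
    rw [show shifted f e = 0 from shifted_last hN hf0] at h1
    rw [show shifted g e = 0 from shifted_last hN hg0] at h2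
    have := gnn (π e)
    have := fnn (π.symm e)
    omega
  apply shifted_injective
  refine ((shifted_strictAnti hf).range_inj (shifted_strictAnti hg)).1 ?_
  rw [show shifted f = shifted g ∘ π from funext heq, π.surjective.range_comp]

/-- The alternant `det(z_i ^ a_j)`. -/
noncomputable def alternant {N : ℕ} (z : Fin N → ℂ) (a : Fin N → ℤ) : ℂ :=
  Matrix.det (Matrix.of fun i j => z i ^ a j)

theorem alternant_comp_perm {N : ℕ} (z : Fin N → ℂ) (a : Fin N → ℤ) (σ : Equiv.Perm (Fin N)) :
    alternant z (a ∘ σ) = Equiv.Perm.sign σ * alternant z a :=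
  Matrix.det_permute' σ (Matrix.of fun i j => z i ^ a j)

theorem alternant_add_const {N : ℕ} {z : Fin N → ℂ} (hz : ∀ i, z i ≠ 0) (hp : ∏ i, z i = 1)
    (a : Fin N → ℤ) (k : ℤ) : alternant z (fun j => a j + k) = alternant z a := by
  have h := Matrix.det_mul_column (fun i => z i ^ k) (Matrix.of fun i j => z i ^ a j)
  rw [prod_zpow, hp, one_zpow, one_mul] at h
  rw [alternant, alternant, ← h]
  congr 1
  ext i j
  simp [zpow_add₀ (hz i), mul_comm]

theorem alternant_add_mul {N : ℕ} {z : Fin N → ℂ} (hz : ∀ i, z i ≠ 0) {c : ℤ} {u : ℂ}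
    (hu : ∀ i, z i ^ c = u) (a m : Fin N → ℤ) :
    alternant z (fun j => a j + c * m j) = (∏ j, u ^ m j) * alternant z a := by
  rw [alternant, alternant, ← Matrix.det_mul_row]
  congr 1
  ext i j
  simp [zpow_add₀ (hz i), zpow_mul, hu i, mul_comm]

theorem alternant_eq_zero_of_dvd {N : ℕ} {z : Fin N → ℂ} (hz : ∀ i, z i ≠ 0) {c : ℤ} {u : ℂ}
    (hu : ∀ i, z i ^ c = u) (a : Fin N → ℤ) {i j : Fin N} (hij : i ≠ j) (hd : c ∣ a i - a j) :
    alternant z a = 0 := by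
  obtain ⟨q, hq⟩ := hd
  have h := alternant_add_mul hz hu (Function.update a i (a j)) (Pi.single i q)
  rw [show alternant z (Function.update a i (a j)) = 0 from
    Matrix.det_zero_of_column_eq hij (fun k => by simp [Function.update_of_ne hij.symm]),
    mul_zero] at h
  rw [← h]
  congr 1
  ext k
  rcases eq_or_ne k i with rfl | hk
  · simp [← hq]
  · simp [hk]

theorem alternant_add_mul_of_sum_eq_zero {N : ℕ} {z : Fin N → ℂ} (hz : ∀ i, z i ≠ 0) {c : ℤ}
    {u : ℂ} (hu0 : u ≠ 0) (hu : ∀ i, z i ^ c = u) (a m : Fin N → ℤ) (hm : ∑ j, m j = 0) :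
    alternant z (fun j => a j + c * m j) = alternant z a := by
  have key : ∀ s : Finset (Fin N), ∏ j ∈ s, u ^ m j = u ^ ∑ j ∈ s, m j := by
    intro s
    induction s using Finset.induction_on with
    | empty => simp
    | insert i s hi ih => rw [prod_insert hi, sum_insert hi, ih, zpow_add₀ hu0]
  rw [alternant_add_mul hz hu, key, hm, zpow_zero, one_mul]

/-- Reduction to the fundamental alcove: a property of points of `ℤ^N` that is stable under the
affine Weyl group and under diagonal translations, and that holds on the walls and on the points
attached to normalised permissible signatures, holds everywhere. -/
theorem alcove_induction {N : ℕ} (ℓ : ℕ) (hN : 1 ≤ N) (P : (Fin N → ℤ) → Prop)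
    (perm : ∀ (a : Fin N → ℤ) (σ : Equiv.Perm (Fin N)), P (a ∘ σ) → P a)
    (translate : ∀ (a : Fin N → ℤ) (k : ℤ), P (fun j => a j + k) → P a)
    (lattice : ∀ a m : Fin N → ℤ, ∑ j, m j = 0 →
      P (fun j => a j + ((N : ℤ) + ℓ) * m j) → P a)
    (wall : ∀ (a : Fin N → ℤ) (i j : Fin N), i ≠ j → ((N : ℤ) + ℓ) ∣ a i - a j → P a)
    (interior : ∀ f : PermSig N ℓ hN, P (shifted f.1)) (a : Fin N → ℤ) : P a := by
  induction hn : (∑ i, a i ^ 2).toNat using Nat.strong_induction_on generalizing a with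
  | _ n ih =>
  subst hn
  by_cases hbig : ∃ i j, (N : ℤ) + ℓ < a i - a j
  · obtain ⟨i, j, hij⟩ := hbig
    have hne : i ≠ j := by
      rintro rfl
      omega
    have hm : ∑ k, (Pi.single j 1 - Pi.single i 1 : Fin N → ℤ) k = 0 := by
      simp [sum_sub_distrib]
    refine lattice a _ hm (ih _ ?_ _ rfl)
    have hcalc : ∑ k, (a k + ((N : ℤ) + ℓ) * (Pi.single j 1 - Pi.single i 1 : Fin N → ℤ) k) ^ 2
        = ∑ k, a k ^ 2 - 2 * ((N : ℤ) + ℓ) * (a i - a j - ((N : ℤ) + ℓ)) := by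
      have : ∀ k, (a k + ((N : ℤ) + ℓ) * (Pi.single j 1 - Pi.single i 1 : Fin N → ℤ) k) ^ 2
          = a k ^ 2 + (Pi.single j (2 * ((N : ℤ) + ℓ) * a j + ((N : ℤ) + ℓ) ^ 2) : Fin N → ℤ) k
            + (Pi.single i (-2 * ((N : ℤ) + ℓ) * a i + ((N : ℤ) + ℓ) ^ 2) : Fin N → ℤ) k := by
        intro k
        rcases eq_or_ne k i with rfl | hki
        · simp [hne]
          ring
        · rcases eq_or_ne k j with rfl | hkj
          · simp [hki]
            ring
          · simp [hki, hkj]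
      simp only [this, sum_add_distrib, Finset.sum_pi_single', mem_univ, if_true]
      ring
    have hpos : 0 < 2 * ((N : ℤ) + ℓ) * (a i - a j - ((N : ℤ) + ℓ)) :=
      mul_pos (by omega) (by omega)
    have hnn : 0 ≤ ∑ k, (a k + ((N : ℤ) + ℓ) *
        (Pi.single j 1 - Pi.single i 1 : Fin N → ℤ) k) ^ 2 := sum_nonneg fun k _ => sq_nonneg _
    omega
  · push Not at hbig
    by_cases hw : ∃ i j, i ≠ j ∧ ((N : ℤ) + ℓ) ∣ a i - a j
    · obtain ⟨i, j, hij, hd⟩ := hw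
      exact wall a i j hij hd
    push Not at hw
    have hinj : Function.Injective a := by
      intro i j hij
      by_contra hne
      exact hw i j hne (by simp [hij])
    have hlt : ∀ i j, a i - a j < (N : ℤ) + ℓ := by
      intro i j
      rcases eq_or_ne i j with rfl | hne
      · simp
        omega
      · refine lt_of_le_of_ne (hbig i j) fun h => hw i j hne (by rw [h])
    obtain ⟨n, rfl⟩ : ∃ n, N = n + 1 := ⟨N - 1, by omega⟩
    set σ := Tuple.sort fun i => -a i
    have hmono : Monotone ((fun i => -a i) ∘ σ) := Tuple.monotone_sort _
    have hstep : ∀ i : Fin n, a (σ i.succ) + 1 ≤ a (σ i.castSucc) := by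
      intro i
      have h1 : -a (σ i.castSucc) ≤ -a (σ i.succ) := hmono (Fin.castSucc_lt_succ).le
      have h2 : a (σ i.succ) ≠ a (σ i.castSucc) := fun h =>
        (Fin.castSucc_lt_succ (i := i)).ne' (σ.injective (hinj h))
      omega
    refine perm a σ (translate _ (-a (σ (Fin.last n))) ?_)
    let f : Fin (n + 1) → ℤ := fun i => a (σ i) - a (σ (Fin.last n)) - n + (i : ℕ)
    have hf : Antitone f := Fin.antitone_iff_succ_le.2 fun i => by
      have := hstep i
      simp only [f, Fin.val_succ, Fin.val_castSucc]
      push_cast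
      omega
    have hfl : f (Fin.last n) = 0 := by simp [f]
    have hf0 : f 0 ≤ ℓ := by
      have := hlt (σ 0) (σ (Fin.last n))
      simp only [f, Fin.val_zero]
      push_cast at this ⊢
      omega
    have := interior ⟨f, fun i j h => hf h, hfl, hf0⟩
    convert this using 1
    ext i
    simp only [shifted, f, Function.comp]
    push_cast
    ring

/-- The numerators of the Weyl quotients are symmetric in the two signatures. -/
theorem det_Dpoint_eq_alternant (N ℓ : ℕ) (f h : Fin N → ℤ) :
    Matrix.det (Matrix.of fun i j : Fin N =>
      Dpoint N ℓ h j ^ (f i + (N : ℤ) - 1 - (i : ℕ))) = alternant (Dpoint N ℓ f) (shifted h) := by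
  let v (a b : Fin N → ℤ) (i : Fin N) : ℂ := Complex.exp (2 * (Real.pi : ℂ) * Complex.I *
    (-(shifted a i : ℂ) * ((∑ k, (shifted b k : ℂ)) / N) / ((N : ℂ) + ℓ)))
  let E : Matrix (Fin N) (Fin N) ℂ := Matrix.of fun i j =>
    Complex.exp (2 * (Real.pi : ℂ) * Complex.I *
      ((shifted f i : ℂ) * shifted h j / ((N : ℂ) + ℓ)))
  have h1 : (Matrix.of fun i j : Fin N => Dpoint N ℓ h j ^ (f i + (N : ℤ) - 1 - (i : ℕ))) =
      Matrix.of fun i j => v f h i * E i j := by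
    ext i j
    simp only [Matrix.of_apply, E, v]
    rw [← shifted.eq_1 f i, Dpoint_eq, ← Complex.exp_int_mul, ← Complex.exp_add]
    congr 1
    ring
  have h2 : (Matrix.of fun i j : Fin N => Dpoint N ℓ f i ^ shifted h j) =
      Matrix.of fun i j => v h f j * E i j := by
    ext i j
    simp only [Matrix.of_apply, E, v]
    rw [Dpoint_eq, ← Complex.exp_int_mul, ← Complex.exp_add]
    congr 1
    ring
  have hv : ∏ i, v f h i = ∏ i, v h f i := by
    simp only [v]
    rw [← Complex.exp_sum, ← Complex.exp_sum]
    congr 1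
    simp only [← mul_sum, ← sum_div, ← sum_mul, sum_neg_distrib]
    ring
  rw [alternant, h1, h2, Matrix.det_mul_column, Matrix.det_mul_row, hv]

/-- The character `a ↦ ∏ z_j ^ a_j` of `ℤ^N`. -/
noncomputable def torusChar {N : ℕ} (z : Fin N → ℂ) (hz : ∀ i, z i ≠ 0) :
    Multiplicative (Fin N → ℤ) →* ℂ where
  toFun a := ∏ j, z j ^ a.toAdd j
  map_one' := by simp
  map_mul' a b := by simp [zpow_add₀ (hz _), prod_mul_distrib]

theorem torusChar_apply {N : ℕ} (z : Fin N → ℂ) (hz : ∀ i, z i ≠ 0)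
    (a : Multiplicative (Fin N → ℤ)) : torusChar z hz a = ∏ j, z j ^ a.toAdd j := rfl

theorem torusChar_inj {N : ℕ} {z w : Fin N → ℂ} {hz : ∀ i, z i ≠ 0} {hw : ∀ i, w i ≠ 0}
    (h : torusChar z hz = torusChar w hw) : z = w := by
  ext i
  have := DFunLike.congr_fun h (Multiplicative.ofAdd (Pi.single i 1))
  simpa [torusChar_apply, Pi.single_apply, apply_ite, prod_ite_eq'] using this

theorem alternant_eq_sum {N : ℕ} (z : Fin N → ℂ) (hz : ∀ i, z i ≠ 0) (a : Fin N → ℤ) :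
    alternant z a = ∑ σ : Equiv.Perm (Fin N), (Equiv.Perm.sign σ : ℂ) *
      torusChar (z ∘ σ) (fun i => hz (σ i)) (Multiplicative.ofAdd a) := by
  simp [alternant, Matrix.det_apply', torusChar_apply]

/-- The alternants of the points `D(f)` are linearly independent on `ℤ^N`. -/
theorem linearIndependent_alternant (N ℓ : ℕ) (hN : 1 ≤ N) :
    LinearIndependent ℂ (fun (f : PermSig N ℓ hN) => alternant (Dpoint N ℓ f.1)) := by
  let χ (p : PermSig N ℓ hN × Equiv.Perm (Fin N)) : Multiplicative (Fin N → ℤ) →* ℂ :=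
    torusChar (Dpoint N ℓ p.1.1 ∘ p.2) (fun i => Dpoint_ne_zero N ℓ p.1.1 (p.2 i))
  have hχ : Function.Injective χ := by
    rintro ⟨f, σ⟩ ⟨g, τ⟩ h
    have h1 : Dpoint N ℓ f.1 ∘ σ = Dpoint N ℓ g.1 ∘ τ := torusChar_inj h
    have hfg : f = g := Subtype.ext <| eq_of_Dpoint_eq_comp_perm hN f.2.1 f.2.2.1 f.2.2.2
      g.2.1 g.2.2.1 g.2.2.2 (σ.symm.trans τ) fun i => by simpa using congrFun h1 (σ.symm i)
    subst hfg
    have hστ : σ = τ := Equiv.ext fun i =>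
      Dpoint_injective hN f.2.1 f.2.2.1 f.2.2.2 (congrFun h1 i)
    rw [hστ]
  have hind := (linearIndependent_monoidHom (Multiplicative (Fin N → ℤ)) ℂ).comp χ hχ
  rw [linearIndependent_iff'] at hind ⊢
  intro s c hc f hf
  have := hind (s ×ˢ univ) (fun p => c p.1 * (Equiv.Perm.sign p.2 : ℂ)) ?_ (f, 1)
    (by simp [hf])
  · simpa using this
  · rw [sum_product]
    ext a
    have ha := congrFun hc a.toAdd
    simp only [Finset.sum_apply, Pi.smul_apply, smul_eq_mul, Pi.zero_apply,
      alternant_eq_sum _ (Dpoint_ne_zero N ℓ _), mul_sum] at ha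
    simpa [χ, mul_assoc] using ha

end WeylAlternant

open WeylAlternant

/-- (1) each `D(h)` has pairwise distinct coordinates; (2) the functions
`h ↦ X_f(D(h))`, for `f` ranging over the normalised permissible signatures, are
linearly independent as `ℂ`-valued functions on the set of such signatures. -/
theorem weyl_characters_linear_independent (N ℓ : ℕ) (hN : 1 ≤ N) :
    (∀ h : Fin N → ℤ, (∀ i j : Fin N, i ≤ j → h j ≤ h i) →
      h ⟨N - 1, by omega⟩ = 0 → h ⟨0, by omega⟩ ≤ (ℓ : ℤ) →
      Function.Injective (Dpoint N ℓ h)) ∧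
    LinearIndependent ℂ
      (fun (f : PermSig N ℓ hN) (h : PermSig N ℓ hN) =>
        weylQuotient N f.1 (Dpoint N ℓ h.1)) := by
  refine ⟨fun h hh h0 hl => Dpoint_injective hN hh h0 hl, ?_⟩
  rw [linearIndependent_iff']
  intro s c hc
  refine linearIndependent_iff'.1 (linearIndependent_alternant N ℓ hN) s c (funext fun a => ?_)
  simp only [Finset.sum_apply, Pi.smul_apply, smul_eq_mul, Pi.zero_apply]
  let u (f : Fin N → ℤ) : ℂ :=
    Complex.exp (2 * (Real.pi : ℂ) * Complex.I * (-(∑ k, (shifted f k : ℂ)) / N))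
  have hu0 : ∀ f, u f ≠ 0 := fun f => Complex.exp_ne_zero _
  have hu : ∀ f i, Dpoint N ℓ f i ^ ((N : ℤ) + ℓ) = u f := fun f i => Dpoint_zpow_level ℓ hN f i
  induction a using alcove_induction ℓ hN with
  | perm a σ ih =>
    simp only [alternant_comp_perm, mul_left_comm (c _), ← Finset.mul_sum] at ih
    refine (mul_eq_zero.1 ih).resolve_left ?_
    exact_mod_cast (Equiv.Perm.sign σ).ne_zero
  | translate a k ih =>
    simpa only [alternant_add_const (Dpoint_ne_zero N ℓ _) (prod_Dpoint ℓ hN _)] using ih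
  | lattice a m hm ih =>
    simpa only [alternant_add_mul_of_sum_eq_zero (Dpoint_ne_zero N ℓ _) (hu0 _) (hu _) a m hm]
      using ih
  | wall a i j hij hd =>
    refine Finset.sum_eq_zero fun f _ => ?_
    rw [alternant_eq_zero_of_dvd (Dpoint_ne_zero N ℓ _) (hu _) a hij hd, mul_zero]
  | interior h =>
    have hV : ∏ p ∈ Finset.univ.filter (fun p : Fin N × Fin N => p.1 < p.2),
        (Dpoint N ℓ h.1 p.1 - Dpoint N ℓ h.1 p.2) ≠ 0 := by
      refine Finset.prod_ne_zero_iff.2 fun p hp => sub_ne_zero.2 fun heq => ?_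
      exact (Finset.mem_filter.1 hp).2.ne
        (Dpoint_injective hN h.2.1 h.2.2.1 h.2.2.2 heq)
    have h1 := congrFun hc h
    simp only [Finset.sum_apply, Pi.smul_apply, smul_eq_mul, Pi.zero_apply, weylQuotient,
      det_Dpoint_eq_alternant, ← mul_div_assoc, ← Finset.sum_div] at h1
    exact (div_eq_zero_iff.1 h1).resolve_right hV
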